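/- arXiv:2002.07570 — 2 statements merged into one kernel-verified Lean document; each statement's English description precedes it below -/
import Mathlib

section
/- Let μ be a Radon measure on a separable Hilbert space H, V an m-dimensional linear subspace, α ∈ (0,1), and 0 < r < ∞. Suppose that for μ-a.e. x ∈ H, μ(C_B(x, V, α) ∩ B(x, r)) = 0. Then μ is carried by m-dimensional Lipschitz graphs: there exist countably many Lipschitz graphs Γ_i over m-planes such that μ(H \ ⋃_i Γ_i) = 0. -/
open MeasureTheory Metric Set ENNReal NNReal

/-- The bad cone at `x` with respect to the subspace `V` and aperture `α`. -/
def badCone {H : Type*} [NormedAddCommGroup H] [InnerProductSpace ℝ H]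
    (x : H) (V : Submodule ℝ H) (α : ℝ) : Set H :=
  {y | α * dist y x < Metric.infDist (y - x) (V : Set H)}

/-- `Γ` is an `m`-dimensional Lipschitz graph: the graph `{v + f(v) : v ∈ W}` of a Lipschitz
map `f : W → W^⊥` over an `m`-dimensional subspace `W`. -/
def IsLipschitzGraph {H : Type*} [NormedAddCommGroup H] [InnerProductSpace ℝ H]
    (m : ℕ) (Γ : Set H) : Prop :=
  ∃ (W : Submodule ℝ H) (f : W → H) (L : ℝ≥0),
    FiniteDimensional ℝ W ∧ Module.finrank ℝ W = m ∧
    LipschitzWith L f ∧ (∀ v : W, f v ∈ Wᗮ) ∧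
    Γ = {x | ∃ v : W, x = (v : H) + f v}


section Helpers

open scoped RealInnerProductSpace

/-- One-point extension step, in terms of a convex hull in `F × E × ℝ`. -/
theorem kirszbraun_point {E F : Type*} [NormedAddCommGroup E] [InnerProductSpace ℝ E]
    [NormedAddCommGroup F] [InnerProductSpace ℝ F] [CompleteSpace F]
    (G : Set (E × F)) (hG : ∀ p ∈ G, ∀ q ∈ G, ‖p.2 - q.2‖ ≤ ‖p.1 - q.1‖) :
    ∃ y : F, ∀ p ∈ G, ‖y - p.2‖ ≤ ‖p.1‖ := by
  rcases G.eq_empty_or_nonempty with rfl | ⟨p₀, hp₀⟩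
  · exact ⟨0, by simp⟩
  let g : E × F → F × E × ℝ := fun p => (p.2, p.1, ‖p.2‖ ^ 2 - ‖p.1‖ ^ 2)
  let C : Set (F × E × ℝ) := convexHull ℝ (g '' G)
  have hCconv : Convex ℝ C := convex_convexHull ℝ _
  have hgC : ∀ p ∈ G, g p ∈ C := fun p hp => subset_convexHull ℝ _ ⟨p, hp, rfl⟩
  have half : ∀ (a : F) (b : E) (k : ℝ),
      Convex ℝ {z : F × E × ℝ | z.2.2 + k - 2 * (⟪a, z.1⟫ - ⟪b, z.2.1⟫) ≤ 0} := by
    intro a b k z hz w hw s t hs ht hst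
    simp only [mem_ofPred_eq, Prod.fst_add, Prod.snd_add, Prod.smul_fst, Prod.smul_snd,
      inner_add_right, inner_smul_right, smul_eq_mul] at *
    have h1 := mul_nonpos_of_nonneg_of_nonpos hs hz
    have h2 := mul_nonpos_of_nonneg_of_nonpos ht hw
    have h3 : k = s * k + t * k := by rw [← add_mul, hst, one_mul]
    rw [h3]; nlinarith
  have h1 : ∀ p ∈ G, ∀ z ∈ C, z.2.2 + (‖p.2‖ ^ 2 - ‖p.1‖ ^ 2)
      - 2 * (⟪p.2, z.1⟫ - ⟪p.1, z.2.1⟫) ≤ 0 := by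
    intro p hp z hz
    refine convexHull_min ?_ (half p.2 p.1 (‖p.2‖ ^ 2 - ‖p.1‖ ^ 2)) hz
    rintro _ ⟨q, hq, rfl⟩
    have h := hG p hp q hq
    have h' := pow_le_pow_left₀ (norm_nonneg _) h 2
    rw [norm_sub_sq_real, norm_sub_sq_real] at h'
    simp only [g, mem_ofPred_eq]
    linarith
  have h2 : ∀ w ∈ C, ∀ z ∈ C, z.2.2 + w.2.2 - 2 * (⟪w.1, z.1⟫ - ⟪w.2.1, z.2.1⟫) ≤ 0 := by
    intro w hw z hz
    refine convexHull_min ?_ (half w.1 w.2.1 w.2.2) hz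
    rintro _ ⟨q, hq, rfl⟩
    have h := h1 q hq w hw
    simp only [g, mem_ofPred_eq]
    rw [real_inner_comm w.1, real_inner_comm w.2.1] at h
    linarith
  let φ : F × E × ℝ → ℝ := fun z => z.2.2 - ‖z.1‖ ^ 2
  have h3 : ∀ z ∈ C, φ z ≤ 0 := by
    intro z hz
    have h := h2 z hz z hz
    rw [real_inner_self_eq_norm_sq, real_inner_self_eq_norm_sq] at h
    simp only [φ]
    nlinarith [sq_nonneg ‖z.2.1‖]
  have hφ : ∀ (z w : F × E × ℝ) (t : ℝ), φ ((1 - t) • z + t • w)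
      = (1 - t) * φ z + t * φ w + t * (1 - t) * ‖z.1 - w.1‖ ^ 2 := by
    intro z w t
    simp only [φ, Prod.fst_add, Prod.snd_add, Prod.smul_fst, Prod.smul_snd, smul_eq_mul]
    rw [norm_add_sq_real, norm_sub_sq_real, norm_smul, norm_smul, mul_pow, mul_pow,
      inner_smul_left, inner_smul_right, Real.norm_eq_abs, Real.norm_eq_abs, sq_abs, sq_abs]
    simp only [conj_trivial]
    ring
  have hne : (φ '' C).Nonempty := ⟨_, _, hgC p₀ hp₀, rfl⟩
  have hbdd : BddAbove (φ '' C) := ⟨0, by rintro _ ⟨z, hz, rfl⟩; exact h3 z hz⟩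
  set S := sSup (φ '' C) with hS
  have hS0 : S ≤ 0 := csSup_le hne (by rintro _ ⟨z, hz, rfl⟩; exact h3 z hz)
  have hle : ∀ z ∈ C, φ z ≤ S := fun z hz => le_csSup hbdd ⟨z, hz, rfl⟩
  have hex : ∀ n : ℕ, ∃ z ∈ C, S - 1 / ((n : ℝ) + 1) < φ z := by
    intro n
    obtain ⟨_, ⟨z, hz, rfl⟩, h⟩ := exists_lt_of_lt_csSup hne
      (show S - 1 / ((n : ℝ) + 1) < sSup (φ '' C) by
        rw [← hS]; have : 0 < 1 / ((n : ℝ) + 1) := by positivity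
        linarith)
    exact ⟨z, hz, h⟩
  choose z hzC hz using hex
  have hcv : ∀ a ∈ C, ∀ b ∈ C, ∀ t : ℝ, 0 ≤ t → t ≤ 1 → 
      (1 - t) * φ a + t * φ b + t * (1 - t) * ‖a.1 - b.1‖ ^ 2 ≤ S := by
    intro a ha b hb t h0 h1
    rw [← hφ]
    exact hle _ (hCconv ha hb (by linarith) h0 (by ring))
  have hlim0 := tendsto_one_div_add_atTop_nhds_zero_nat (𝕜 := ℝ)
  have hcau : CauchySeq fun n => (z n).1 := by
    refine cauchySeq_of_le_tendsto_0 (fun n : ℕ => √(4 * (1 / ((n : ℝ) + 1)))) ?_ ?_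
    · intro n k N hn hk
      rw [dist_eq_norm]
      apply Real.le_sqrt_of_sq_le
      have h := hcv _ (hzC n) _ (hzC k) (1 / 2) (by norm_num) (by norm_num)
      have a1 := hz n
      have a2 := hz k
      have b1 : 1 / ((n : ℝ) + 1) ≤ 1 / ((N : ℝ) + 1) := by gcongr
      have b2 : 1 / ((k : ℝ) + 1) ≤ 1 / ((N : ℝ) + 1) := by gcongr
      linarith
    · have := (hlim0.const_mul 4).sqrt
      simpa using this
  obtain ⟨y, hy⟩ := cauchySeq_tendsto_of_complete hcau
  refine ⟨y, fun p hp => ?_⟩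
  have hφg : φ (g p) = - ‖p.1‖ ^ 2 := by simp [φ, g]
  have key : ∀ t : ℝ, 0 < t → t ≤ 1 → (1 - t) * ‖y - p.2‖ ^ 2 ≤ ‖p.1‖ ^ 2 := by
    intro t ht ht1
    have hl : ∀ n : ℕ, (1 - t) * (S - 1 / ((n : ℝ) + 1)) + t * (- ‖p.1‖ ^ 2)
        + t * (1 - t) * ‖(z n).1 - p.2‖ ^ 2 ≤ S := by
      intro n
      have h := hcv _ (hzC n) _ (hgC p hp) t ht.le ht1
      rw [hφg] at h
      have := mul_le_mul_of_nonneg_left (hz n).le (sub_nonneg.2 ht1)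
      simp only [g] at h
      linarith
    have hT : Filter.Tendsto (fun n : ℕ => (1 - t) * (S - 1 / ((n : ℝ) + 1)) + t * (- ‖p.1‖ ^ 2)
        + t * (1 - t) * ‖(z n).1 - p.2‖ ^ 2) Filter.atTop
        (nhds ((1 - t) * (S - 0) + t * (- ‖p.1‖ ^ 2) + t * (1 - t) * ‖y - p.2‖ ^ 2)) :=
      (((hlim0.const_sub S).const_mul _).add_const _).add
        (((hy.sub_const p.2).norm.pow 2).const_mul _)
    have h := le_of_tendsto' hT hl
    have h' : t * ((1 - t) * ‖y - p.2‖ ^ 2) ≤ t * ‖p.1‖ ^ 2 := by nlinarith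
    exact le_of_mul_le_mul_left h' ht
  have hfin : ‖y - p.2‖ ^ 2 ≤ ‖p.1‖ ^ 2 := by
    have hT : Filter.Tendsto (fun n : ℕ => (1 - 1 / ((n : ℝ) + 1)) * ‖y - p.2‖ ^ 2) Filter.atTop
        (nhds ((1 - 0) * ‖y - p.2‖ ^ 2)) := (hlim0.const_sub 1).mul_const _
    have h := le_of_tendsto' hT (fun n => key _ (by positivity)
      (by rw [div_le_one (by positivity)]; linarith [(Nat.cast_nonneg n : (0:ℝ) ≤ n)]))
    simpa using h
  exact le_of_sq_le_sq hfin (norm_nonneg _)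

theorem kirszbraun_ext {E F : Type*} [NormedAddCommGroup E] [InnerProductSpace ℝ E]
    [NormedAddCommGroup F] [InnerProductSpace ℝ F] [CompleteSpace F] (L : ℝ≥0)
    (G : Set (E × F)) (hG : ∀ p ∈ G, ∀ q ∈ G, ‖p.2 - q.2‖ ≤ L * ‖p.1 - q.1‖) :
    ∃ f : E → F, LipschitzWith L f ∧ ∀ p ∈ G, f p.1 = p.2 := by
  obtain ⟨M, hGM, hM⟩ := zorn_subset_nonempty
    {G : Set (E × F) | ∀ p ∈ G, ∀ q ∈ G, ‖p.2 - q.2‖ ≤ L * ‖p.1 - q.1‖} (by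
      intro c hc hch _
      refine ⟨⋃₀ c, ?_, fun s hs => subset_sUnion_of_mem hs⟩
      rintro p ⟨s, hs, hps⟩ q ⟨t, ht, hqt⟩
      rcases hch.total hs ht with h | h
      · exact hc ht p (h hps) q hqt
      · exact hc hs p hps q (h hqt)) G hG
  have hMp := hM.prop
  simp only [mem_ofPred_eq] at hMp
  have hdom : ∀ x : E, ∃ y : F, (x, y) ∈ M := by
    intro x
    obtain ⟨y, hy⟩ := kirszbraun_point ((fun p : E × F => ((L : ℝ) • (p.1 - x), p.2)) '' M) (by
      rintro _ ⟨p, hp, rfl⟩ _ ⟨q, hq, rfl⟩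
      simp only [← smul_sub, sub_sub_sub_cancel_right, norm_smul, Real.norm_eq_abs, NNReal.abs_eq]
      exact hMp p hp q hq)
    have hy' : ∀ p ∈ M, ‖y - p.2‖ ≤ L * ‖p.1 - x‖ := by
      intro p hp
      have := hy _ ⟨p, hp, rfl⟩
      simpa [norm_smul] using this
    refine ⟨y, hM.le_of_ge (y := insert (x, y) M) ?_ (subset_insert _ _) (mem_insert _ _)⟩
    rintro p (rfl | hp) q (rfl | hq)
    · simp
    · rw [norm_sub_rev (x, y).1]; exact hy' q hq
    · rw [norm_sub_rev]; exact hy' p hp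
    · exact hMp p hp q hq
  choose f hf using hdom
  refine ⟨f, LipschitzWith.of_dist_le_mul fun a b => ?_, fun p hp => ?_⟩
  · rw [dist_eq_norm, dist_eq_norm]; exact hMp _ (hf a) _ (hf b)
  · have := hMp _ (hf p.1) _ (hGM hp)
    simpa [sub_eq_zero] using this

theorem graph_of_no_cone {H : Type*} [NormedAddCommGroup H] [InnerProductSpace ℝ H]
    [CompleteSpace H] (m : ℕ) (V : Submodule ℝ H) [FiniteDimensional ℝ V]
    (hm : Module.finrank ℝ V = m) (α : ℝ) (hα : α ∈ Set.Ioo (0 : ℝ) 1) (A : Set H)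
    (hA : ∀ x ∈ A, ∀ y ∈ A, y ∉ badCone x V α) :
    ∃ Γ : Set H, IsLipschitzGraph m Γ ∧ A ⊆ Γ := by
  obtain ⟨h0, h1⟩ := hα
  have h1' : 0 < 1 - α := by linarith
  let L : ℝ≥0 := ⟨α / (1 - α), by positivity⟩
  obtain ⟨f, hf, hfA⟩ := kirszbraun_ext (E := V) (F := Vᗮ) L
    ((fun x => (V.orthogonalProjectionOnto x, Vᗮ.orthogonalProjectionOnto x)) '' A) (by
      rintro _ ⟨x, hx, rfl⟩ _ ⟨y, hy, rfl⟩
      have h := hA y hy x hx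
      simp only [badCone, mem_ofPred_eq, not_lt] at h
      simp only [← map_sub]
      rw [dist_eq_norm] at h
      generalize x - y = z at *
      have hz : V.starProjection z + Vᗮ.starProjection z = z :=
        V.starProjection_add_starProjection_orthogonal z
      have hn : ‖z‖ ≤ ‖V.orthogonalProjectionOnto z‖ + ‖Vᗮ.orthogonalProjectionOnto z‖ := by
        conv_lhs => rw [← hz]
        exact norm_add_le _ _
      have hd : ‖Vᗮ.orthogonalProjectionOnto z‖ ≤ infDist z (V : Set H) := by
        rw [Metric.le_infDist ⟨0, V.zero_mem⟩]
        intro v hv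
        have : Vᗮ.orthogonalProjectionOnto z = Vᗮ.orthogonalProjectionOnto (z - v) := by
          rw [map_sub, Submodule.orthogonalProjectionOnto_orthogonal_apply_eq_zero hv, sub_zero]
        rw [this, dist_eq_norm]
        exact Vᗮ.norm_orthogonalProjectionOnto_apply_le _
      change _ ≤ α / (1 - α) * _
      rw [div_mul_eq_mul_div, le_div_iff₀ h1']
      nlinarith)
  refine ⟨_, ⟨V, fun v => (f v : H), L, inferInstance, hm, ?_, fun v => (f v).2, rfl⟩, ?_⟩
  · exact LipschitzWith.of_dist_le_mul fun a b => hf.dist_le_mul a b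
  · intro x hx
    refine ⟨V.orthogonalProjectionOnto x, ?_⟩
    have := hfA _ ⟨x, hx, rfl⟩
    simp only at this
    beta_reduce
    rw [this]
    exact (V.starProjection_add_starProjection_orthogonal x).symm

end Helpers

/-- If for `μ`-a.e. `x` the bad cone of aperture `α` around `V` at scale `r` carries no mass,
then `μ` is carried by `m`-dimensional Lipschitz graphs. -/
theorem statement10 {H : Type*} [NormedAddCommGroup H] [InnerProductSpace ℝ H]
    [SecondCountableTopology H] [CompleteSpace H] [MeasurableSpace H] [BorelSpace H]
    (μ : Measure H) [IsLocallyFiniteMeasure μ]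
    (m : ℕ) (V : Submodule ℝ H) [FiniteDimensional ℝ V] (hm : Module.finrank ℝ V = m)
    (α : ℝ) (hα : α ∈ Set.Ioo (0 : ℝ) 1) (r : ℝ) (hr : 0 < r)
    (h : ∀ᵐ x ∂μ, μ (badCone x V α ∩ Metric.closedBall x r) = 0) :
    ∃ Γ : ℕ → Set H, (∀ i, IsLipschitzGraph m (Γ i)) ∧ μ (Set.univ \ ⋃ i, Γ i) = 0 := by
  let F₀ : Set H := {x | μ (badCone x V α ∩ Metric.closedBall x r) = 0}
  have hF₀ : μ F₀ᶜ = 0 := h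
  let c := TopologicalSpace.denseSeq H
  have hc : DenseRange c := TopologicalSpace.denseRange_denseSeq H
  have step : ∀ i : ℕ, ∃ Γ : Set H, IsLipschitzGraph m Γ ∧
      μ ((F₀ ∩ ball (c i) (r / 2)) \ Γ) = 0 := by
    intro i
    obtain ⟨D, hDA, hDc, hD⟩ := (TopologicalSpace.IsSeparable.of_separableSpace
      (F₀ ∩ ball (c i) (r / 2))).exists_countable_dense_subset
    set A := F₀ ∩ ball (c i) (r / 2) with hAdef
    let N : Set H := ⋃ d ∈ D, (badCone d V α ∩ Metric.closedBall d r)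
    have hN : μ N = 0 := (measure_biUnion_null_iff hDc).2 fun d hd => (hDA hd).1
    obtain ⟨Γ, hΓ, hsub⟩ := graph_of_no_cone m V hm α hα (A \ N) (by
      intro x hx y hy hxy
      have hopen : IsOpen {x : H | α * dist y x < infDist (y - x) (V : Set H)} :=
        isOpen_lt (by fun_prop)
          ((continuous_infDist_pt _).comp (continuous_const.sub continuous_id))
      obtain ⟨d, hd1, hd2⟩ := mem_closure_iff.1 (hD hx.1) _ hopen hxy
      refine hy.2 (mem_biUnion hd2 ⟨hd1, ?_⟩)
      have e1 := mem_ball.1 hy.1.2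
      have e2 := mem_ball.1 (hDA hd2).2
      rw [mem_closedBall]
      linarith [dist_triangle_right y d (c i)])
    refine ⟨Γ, hΓ, measure_mono_null (fun x hx => ?_) hN⟩
    by_contra hxN
    exact hx.2 (hsub ⟨hx.1, hxN⟩)
  choose Γ hΓ hμ using step
  refine ⟨Γ, hΓ, measure_mono_null (t := F₀ᶜ ∪ ⋃ i, ((F₀ ∩ ball (c i) (r / 2)) \ Γ i)) ?_
    (measure_union_null hF₀ (measure_iUnion_null hμ))⟩
  rintro x ⟨-, hx⟩
  by_cases hxF : x ∈ F₀
  · obtain ⟨i, hi⟩ := hc.exists_dist_lt x (half_pos hr)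
    exact Or.inr (mem_iUnion.2 ⟨i, ⟨hxF, hi⟩, fun h' => hx (mem_iUnion.2 ⟨i, h'⟩)⟩)
  · exact Or.inl hxF
end

section
/- Let μ be a Radon measure on a separable Hilbert space H that is carried by m-dimensional Lipschitz graphs. Then for μ-a.e. x ∈ H there exist an m-dimensional subspace V and α ∈ (0,1) such that lim_{r↓0} μ(C_B(x, V, α) ∩ B(x, r)) / μ(B(x, r)) = 0. -/
open MeasureTheory Metric Set ENNReal NNReal

/-- Points of the bad cone have small projection onto the plane. -/
lemma badCone_proj {H : Type*} [NormedAddCommGroup H] [InnerProductSpace ℝ H]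
    (W : Submodule ℝ H) [FiniteDimensional ℝ W] (η : ℝ) (h0 : 0 < η) (h1 : η < 1) (x y : H)
    (hy : y ∈ badCone x W (Real.sqrt (1 - η ^ 2))) :
    ‖W.orthogonalProjectionOnto (y - x)‖ ≤ η * ‖y - x‖ ∧ y ≠ x := by
  have hs : 0 ≤ 1 - η ^ 2 := by nlinarith
  simp only [badCone, Set.mem_setOf_eq] at hy
  refine ⟨?_, ?_⟩
  · set u := y - x with hu
    have hd : Metric.infDist u (W : Set H) ≤ ‖u - W.starProjection u‖ := by
      rw [← dist_eq_norm]
      exact Metric.infDist_le_dist_of_mem (W.starProjection_apply_mem u)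
    have e := W.norm_sq_eq_add_norm_sq_starProjection u
    rw [Submodule.starProjection_orthogonal_val] at e
    have e2 : ‖W.orthogonalProjectionOnto u‖ = ‖W.starProjection u‖ := by
      rw [Submodule.starProjection_apply]; rfl
    rw [dist_eq_norm, ← hu] at hy
    rw [e2]
    have h3 : Real.sqrt (1 - η ^ 2) * ‖u‖ ≤ ‖u - W.starProjection u‖ := by linarith
    have h4 := pow_le_pow_left₀ (by positivity) h3 2
    rw [mul_pow, Real.sq_sqrt hs] at h4
    apply le_of_sq_le_sq _ (by positivity)
    rw [mul_pow]
    linarith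
  · rintro rfl
    have : Metric.infDist (0 : H) (W : Set H) = 0 :=
      Metric.infDist_zero_of_mem (W.zero_mem)
    simp [this] at hy

lemma badCone_isOpen {H : Type*} [NormedAddCommGroup H] [InnerProductSpace ℝ H]
    (x : H) (V : Submodule ℝ H) (α : ℝ) : IsOpen (badCone x V α) := by
  unfold badCone
  refine isOpen_lt (by fun_prop) ?_
  exact (Metric.continuous_infDist_pt _).comp (by fun_prop)

/-- The set of parameters at which the bad cone is charged at arbitrarily small scales. -/
def exSet {H : Type*} [NormedAddCommGroup H] [InnerProductSpace ℝ H] [MeasurableSpace H]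
    (μ : Measure H) (W : Submodule ℝ H) (g : W → H) (Λ α : ℝ) (ε : ℝ≥0∞) : Set W :=
  {v | ∀ δ > 0, ∃ ρ ∈ Set.Ioo (0 : ℝ) δ, ε * μ (Metric.closedBall (g v) (Λ * ρ)) ≤
    μ (badCone (g v) W α ∩ Metric.closedBall (g v) (Λ * ρ))}

lemma core_finite {H : Type*} [NormedAddCommGroup H] [InnerProductSpace ℝ H]
    [SecondCountableTopology H] [MeasurableSpace H] [BorelSpace H]
    (μ : Measure H) [IsFiniteMeasure μ] (W : Submodule ℝ H) [FiniteDimensional ℝ W]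
    (g : W → H) (Λ : ℝ) (hΛ : 0 < Λ)
    (hP : ∀ v, W.orthogonalProjectionOnto (g v) = v)
    (hL : ∀ v w, dist (g v) (g w) ≤ Λ * dist v w)
    (hg : Topology.IsClosedEmbedding g)
    (α : ℝ)
    (hc : ∀ x y, y ∈ badCone x W α →
      ‖W.orthogonalProjectionOnto (y - x)‖ ≤ 1 / (2 * Λ) * ‖y - x‖ ∧ y ≠ x)
    (ε : ℝ≥0∞) (hε : ε ≠ 0) : μ (g '' exSet μ W g Λ α ε) = 0 := by
  have hme := hg.measurableEmbedding
  set S := exSet μ W g Λ α ε with hS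
  set ν := μ.comap g with hν
  have hνS : ∀ s, ν s = μ (g '' s) := fun s => hme.comap_apply μ s
  haveI : IsFiniteMeasure ν := ⟨by rw [hνS]; exact measure_lt_top _ _⟩
  have hcl : IsClosed (range g) := hg.isClosed_range
  -- main estimate
  have key : ∀ R > 0, ε * ν S ≤ μ (Metric.cthickening (Λ * R) (range g) \ range g) := by
    intro R hR
    obtain ⟨t, r, htc, htS, htr, hcov, hdisj⟩ :=
      Besicovitch.exists_disjoint_closedBall_covering_ae ν
        (fun v => {ρ | ε * μ (Metric.closedBall (g v) (Λ * ρ)) ≤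
          μ (badCone (g v) W α ∩ Metric.closedBall (g v) (Λ * ρ))}) S
        (fun v hv δ hδ => by
          obtain ⟨ρ, h1, h2⟩ := hv δ hδ
          exact ⟨ρ, h2, h1⟩) (fun _ => R) (fun _ _ => hR)
    haveI := htc.to_subtype
    have h1 : ν S ≤ ∑' v : t, ν (Metric.closedBall (v : W) (r v)) := by
      calc ν S ≤ ν ((S \ ⋃ x ∈ t, Metric.closedBall x (r x)) ∪
              ⋃ x ∈ t, Metric.closedBall x (r x)) := measure_mono (by
                intro z hz; by_cases h : z ∈ ⋃ x ∈ t, Metric.closedBall x (r x)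
                · exact Or.inr h
                · exact Or.inl ⟨hz, h⟩)
        _ ≤ 0 + ν (⋃ x ∈ t, Metric.closedBall x (r x)) := by
            rw [← hcov]; exact measure_union_le _ _
        _ ≤ _ := by rw [zero_add]; exact measure_biUnion_le ν htc _
    have h2 : ∀ v : t, ε * ν (Metric.closedBall (v : W) (r v)) ≤
        μ (badCone (g v) W α ∩ Metric.closedBall (g v) (Λ * r v)) := by
      intro v
      refine le_trans ?_ (htr v v.2).1
      gcongr
      rw [hνS]
      apply measure_mono
      rintro _ ⟨w, hw, rfl⟩
      rw [Metric.mem_closedBall] at hw ⊢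
      exact (hL _ _).trans (by gcongr)
    have hd : Pairwise (Function.onFun Disjoint (fun v : t =>
        badCone (g v) W α ∩ Metric.closedBall (g v) (Λ * r v))) := by
      intro v w hvw
      rw [Function.onFun, Set.disjoint_left]
      rintro y ⟨hy1, hy2⟩ ⟨hy3, hy4⟩
      have hv0 := (htr v v.2).2.1
      have hw0 := (htr w w.2).2.1
      have hdd := hdisj v.2 w.2 (fun h => hvw (Subtype.ext h))
      have hdd := (disjoint_closedBall_closedBall_iff hv0.le hw0.le).1 hdd
      have a1 := (hc _ _ hy1).1
      have a2 := (hc _ _ hy3).1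
      rw [Metric.mem_closedBall, dist_eq_norm] at hy2 hy4
      rw [map_sub, hP] at a1 a2
      have b1 : ‖W.orthogonalProjectionOnto y - v‖ ≤ r v := by
        calc _ ≤ _ := a1
          _ ≤ 1 / (2 * Λ) * (Λ * r v) := by gcongr
          _ = r v / 2 := by field_simp
          _ ≤ r v := by linarith
      have b2 : ‖W.orthogonalProjectionOnto y - w‖ ≤ r w := by
        calc _ ≤ _ := a2
          _ ≤ 1 / (2 * Λ) * (Λ * r w) := by gcongr
          _ = r w / 2 := by field_simp
          _ ≤ r w := by linarith
      rw [← dist_eq_norm] at b1 b2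
      have := dist_triangle_left (v : W) (w : W) (W.orthogonalProjectionOnto y)
      linarith
    calc ε * ν S ≤ ε * ∑' v : t, ν (Metric.closedBall (v : W) (r v)) := by gcongr
      _ = ∑' v : t, ε * ν (Metric.closedBall (v : W) (r v)) := ENNReal.tsum_mul_left.symm
      _ ≤ ∑' v : t, μ (badCone (g v) W α ∩ Metric.closedBall (g v) (Λ * r v)) :=
          ENNReal.tsum_le_tsum h2
      _ = μ (⋃ v : t, badCone (g v) W α ∩ Metric.closedBall (g v) (Λ * r v)) :=
          (measure_iUnion hd (fun v => (badCone_isOpen _ _ _).measurableSet.inter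
            Metric.isClosed_closedBall.measurableSet)).symm
      _ ≤ _ := by
          apply measure_mono
          intro y hy
          obtain ⟨v, hy1, hy2⟩ := Set.mem_iUnion.1 hy
          refine ⟨?_, ?_⟩
          · rw [Metric.mem_closedBall] at hy2
            refine Metric.mem_cthickening_of_dist_le y (g v) _ _ ⟨_, rfl⟩ (hy2.trans ?_)
            have := (htr v v.2).2.2
            gcongr
          · rintro ⟨w, rfl⟩
            obtain ⟨c1, c2⟩ := hc _ _ hy1
            rw [map_sub, hP, hP, ← dist_eq_norm, ← dist_eq_norm] at c1
            have c3 := hL w v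
            have c4 : 0 < dist (g w) (g v) := dist_pos.2 c2
            have c5 : Λ * dist w (v : W) ≤ Λ * (1 / (2 * Λ) * dist (g w) (g v)) := by gcongr
            have c6 : Λ * (1 / (2 * Λ) * dist (g w) (g v)) = dist (g w) (g v) / 2 := by
              field_simp
            linarith
  -- the limit
  have hlim : Filter.Tendsto (fun R : ℝ => μ (Metric.cthickening (Λ * R) (range g) \ range g))
      (nhdsWithin 0 (Ioi 0)) (nhds 0) := by
    have t1 : Filter.Tendsto (fun r => μ (Metric.cthickening r (range g))) (nhds 0)
        (nhds (μ (range g))) :=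
      tendsto_measure_cthickening_of_isClosed ⟨1, one_pos, measure_ne_top _ _⟩ hcl
    have t2 : Filter.Tendsto (fun R : ℝ => Λ * R) (nhdsWithin 0 (Ioi 0)) (nhds 0) := by
      have : Filter.Tendsto (fun R : ℝ => Λ * R) (nhds 0) (nhds (Λ * 0)) :=
        (continuous_const.mul continuous_id).tendsto 0
      rw [mul_zero] at this
      exact this.mono_left nhdsWithin_le_nhds
    have t3 := ENNReal.Tendsto.sub (t1.comp t2)
      (tendsto_const_nhds (x := μ (range g))) (Or.inl (measure_ne_top _ _))
    rw [tsub_self] at t3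
    refine t3.congr fun R => ?_
    rw [measure_sdiff (Metric.self_subset_cthickening _) hcl.measurableSet.nullMeasurableSet
      (measure_ne_top _ _)]
    rfl
  have hle : ε * ν S ≤ 0 :=
    ge_of_tendsto hlim (Filter.eventually_of_mem self_mem_nhdsWithin key)
  have := le_antisymm hle bot_le
  rw [← hνS]
  exact (mul_eq_zero.1 this).resolve_left hε

lemma core_locFinite {H : Type*} [NormedAddCommGroup H] [InnerProductSpace ℝ H]
    [SecondCountableTopology H] [MeasurableSpace H] [BorelSpace H]
    (μ : Measure H) [IsLocallyFiniteMeasure μ] (W : Submodule ℝ H) [FiniteDimensional ℝ W]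
    (g : W → H) (Λ : ℝ) (hΛ : 0 < Λ)
    (hP : ∀ v, W.orthogonalProjectionOnto (g v) = v)
    (hL : ∀ v w, dist (g v) (g w) ≤ Λ * dist v w)
    (hg : Topology.IsClosedEmbedding g)
    (α : ℝ)
    (hc : ∀ x y, y ∈ badCone x W α →
      ‖W.orthogonalProjectionOnto (y - x)‖ ≤ 1 / (2 * Λ) * ‖y - x‖ ∧ y ≠ x)
    (ε : ℝ≥0∞) (hε : ε ≠ 0) : μ (g '' exSet μ W g Λ α ε) = 0 := by
  apply measure_null_of_locally_null
  intro x _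
  obtain ⟨U, hxU, hUo, hUf⟩ := μ.exists_isOpen_measure_lt_top x
  refine ⟨g '' exSet μ W g Λ α ε ∩ U, Filter.inter_mem self_mem_nhdsWithin
    (mem_nhdsWithin_of_mem_nhds (hUo.mem_nhds hxU)), ?_⟩
  haveI : IsFiniteMeasure (μ.restrict U) := ⟨by simpa using hUf⟩
  have h := core_finite (μ.restrict U) W g Λ hΛ hP hL hg α hc ε hε
  have hsub : g '' exSet μ W g Λ α ε ∩ U ⊆ g '' exSet (μ.restrict U) W g Λ α ε := by
    rintro _ ⟨⟨v, hv, rfl⟩, hvU⟩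
    refine ⟨v, ?_, rfl⟩
    obtain ⟨κ, hκ, hκU⟩ := Metric.isOpen_iff.1 hUo _ hvU
    intro δ hδ
    obtain ⟨ρ, ⟨h0, h1⟩, h2⟩ := hv (min δ (κ / Λ)) (by positivity)
    have hρ : Λ * ρ < κ := by
      have := (lt_div_iff₀ hΛ).1 (h1.trans_le (min_le_right _ _)); linarith
    have hb : Metric.closedBall (g v) (Λ * ρ) ⊆ U :=
      (Metric.closedBall_subset_ball hρ).trans hκU
    refine ⟨ρ, ⟨h0, h1.trans_le (min_le_left _ _)⟩, ?_⟩
    rwa [Measure.restrict_eq_self _ hb,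
      Measure.restrict_eq_self _ (inter_subset_right.trans hb)]
  rw [← Measure.restrict_eq_self μ (inter_subset_right : g '' exSet μ W g Λ α ε ∩ U ⊆ U)]
  exact measure_mono_null hsub h

lemma graph_ae {H : Type*} [NormedAddCommGroup H] [InnerProductSpace ℝ H]
    [SecondCountableTopology H] [MeasurableSpace H] [BorelSpace H]
    (μ : Measure H) [IsLocallyFiniteMeasure μ] (m : ℕ) (Γ : Set H)
    (hΓ : IsLipschitzGraph m Γ) :
    ∀ᵐ x ∂μ, x ∈ Γ → ∃ (V : Submodule ℝ H), FiniteDimensional ℝ V ∧ Module.finrank ℝ V = m ∧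
      ∃ α ∈ Set.Ioo (0 : ℝ) 1,
        Filter.Tendsto
          (fun r : ℝ => μ (badCone x V α ∩ Metric.closedBall x r) / μ (Metric.closedBall x r))
          (nhdsWithin 0 (Set.Ioi 0)) (nhds 0) := by
  obtain ⟨W, f, L, hfd, hm, hf, hfp, rfl⟩ := hΓ
  set g : W → H := fun v => (v : H) + f v with hgdef
  set Λ : ℝ := 1 + L with hΛdef
  have hL0 : (0 : ℝ) ≤ L := L.2
  have hΛ : 0 < Λ := by positivity
  have hP : ∀ v, W.orthogonalProjectionOnto (g v) = v := by
    intro v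
    rw [hgdef]
    simp only [map_add]
    rw [Submodule.orthogonalProjectionOnto_mem_subspace_eq_self,
      Submodule.orthogonalProjectionOnto_apply_of_mem_orthogonal (hfp v), add_zero]
  have hL : ∀ v w, dist (g v) (g w) ≤ Λ * dist v w := by
    intro v w
    have h1 := dist_add_add_le (v : H) (f v) (w : H) (f w)
    have h2 := hf.dist_le_mul v w
    have h3 : dist (v : H) (w : H) = dist v w := rfl
    simp only [hgdef, hΛdef]
    linarith
  have hg : Topology.IsClosedEmbedding g := by
    have ha : AntilipschitzWith 1 g := by
      apply AntilipschitzWith.of_le_mul_dist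
      intro v w
      have := W.norm_orthogonalProjectionOnto_apply_le (g v - g w)
      rw [map_sub, hP, hP] at this
      simpa [dist_eq_norm] using this
    refine ha.isClosedEmbedding ?_
    exact (LipschitzWith.of_dist_le_mul (K := Real.toNNReal Λ) (by
      intro v w; rw [Real.coe_toNNReal _ hΛ.le]; exact hL v w)).uniformContinuous
  set η : ℝ := 1 / (2 * Λ) with hη
  have hη0 : 0 < η := by positivity
  have hη1 : η < 1 := by
    rw [hη, div_lt_one (by positivity)]; linarith
  set α := Real.sqrt (1 - η ^ 2) with hα
  have hc : ∀ x y, y ∈ badCone x W α →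
      ‖W.orthogonalProjectionOnto (y - x)‖ ≤ 1 / (2 * Λ) * ‖y - x‖ ∧ y ≠ x :=
    fun x y hy => badCone_proj W η hη0 hη1 x y hy
  have hnull : ∀ n : ℕ, ∀ᵐ x ∂μ, x ∉ g '' exSet μ W g Λ α ((n : ℝ≥0∞)⁻¹) := by
    intro n
    rw [← measure_eq_zero_iff_ae_notMem]
    exact core_locFinite μ W g Λ hΛ hP hL hg α hc _ (by simp)
  filter_upwards [ae_all_iff.2 hnull] with x hx hxΓ
  obtain ⟨v, hv⟩ := hxΓ
  change x = g v at hv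
  subst hv
  refine ⟨W, hfd, hm, α, ⟨?_, ?_⟩, ?_⟩
  · apply Real.sqrt_pos.2; nlinarith
  · rw [hα, Real.sqrt_lt' one_pos]; nlinarith
  rw [ENNReal.tendsto_nhds_zero]
  intro ε hε
  obtain ⟨n, hn⟩ := ENNReal.exists_inv_nat_lt hε.ne'
  have h := fun h => hx n ⟨v, h, rfl⟩
  simp only [exSet, Set.mem_setOf_eq, not_forall, not_exists, not_and, exists_prop] at h
  obtain ⟨δ, hδ, h⟩ := not_forall₂.1 h
  have hmem : Ioo (0 : ℝ) (Λ * δ) ∈ nhdsWithin (0 : ℝ) (Ioi 0) :=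
    Ioo_mem_nhdsGT (by positivity)
  filter_upwards [hmem] with r hr
  by_contra hcon
  push Not at hcon
  apply h
  refine ⟨r / Λ, ⟨by have := hr.1; positivity, ?_⟩, ?_⟩
  · rw [div_lt_iff₀ hΛ]; linarith [hr.2]
  · rw [mul_div_cancel₀ _ hΛ.ne']
    exact ENNReal.mul_le_of_le_div (hn.trans hcon).le

/-- If a Radon measure on a separable Hilbert space is carried by `m`-dimensional Lipschitz
graphs, then at `μ`-a.e. point there are an `m`-plane `V` and `α ∈ (0,1)` for which the
relative mass of the bad cone `C_B(x, V, α) ∩ B(x,r)` tends to `0` as `r ↓ 0`. -/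
theorem statement12 {H : Type*} [NormedAddCommGroup H] [InnerProductSpace ℝ H]
    [SecondCountableTopology H] [CompleteSpace H] [MeasurableSpace H] [BorelSpace H]
    (μ : Measure H) [IsLocallyFiniteMeasure μ] (m : ℕ)
    (hcarried : ∃ Γ : ℕ → Set H, (∀ i, IsLipschitzGraph m (Γ i)) ∧
      μ (Set.univ \ ⋃ i, Γ i) = 0) :
    ∀ᵐ x ∂μ, ∃ (V : Submodule ℝ H), FiniteDimensional ℝ V ∧ Module.finrank ℝ V = m ∧
      ∃ α ∈ Set.Ioo (0 : ℝ) 1,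
        Filter.Tendsto
          (fun r : ℝ => μ (badCone x V α ∩ Metric.closedBall x r) / μ (Metric.closedBall x r))
          (nhdsWithin 0 (Set.Ioi 0)) (nhds 0) := by
  obtain ⟨Γ, hΓ, h0⟩ := hcarried
  have h1 : ∀ᵐ x ∂μ, x ∉ Set.univ \ ⋃ i, Γ i := measure_eq_zero_iff_ae_notMem.1 h0
  filter_upwards [h1, ae_all_iff.2 fun i => graph_ae μ m (Γ i) (hΓ i)] with x hx hall
  have hx' : x ∈ ⋃ i, Γ i := by
    by_contra hne
    exact hx ⟨Set.mem_univ _, hne⟩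
  obtain ⟨i, hi⟩ := Set.mem_iUnion.1 hx'
  exact hall i hi
end
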